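/- In U^♮_χ define B_{n−1} := E_n and, descending, B_i := ⌊E_{N−i−1},⌊B_{i+1},E_{i+1}⌋⌋ for i = n−2,…,1,0; define B_{−1} := ⌊E_N,⌊B_0,E_0⌋⌋, A_0 := B_{−1}, and A_i := ⌊E_{N−i},⌊A_{i−1},E_i⌋⌋ for i = 1,…,n−1 (all q-brackets computed with the degrees inherited from the letters E_s). Then for every i ∈ {0,…,n−1}: ⌊B_i, E_j⌋ = 0 for every j ∈ I with j ∉ {i, N−i−1, N−i}; ⌊E_{N−i−1}, B_i⌋ = 0; ⌊A_i, E_j⌋ = 0 for every j ∈ I with j ∉ {i+1, N−i−1, N−i}; and ⌊E_{N−i}, A_i⌋ = 0. -/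

import Mathlib

/-- Generators of the quantum superalgebra. -/
inductive QGen (Λ I : Type) : Type
  | Kg : Λ → QGen Λ I
  | Lg : Λ → QGen Λ I
  | Eg : I → QGen Λ I
  | Fg : I → QGen Λ I

/-- The lattice `V̂ = (⊕_{i∈I} ℤα_i) ⊕ ℤ∂` for `I = {0,…,N}`, `N = 2n`. -/
abbrev Lam (n : ℕ) : Type := (Fin (2 * n + 1) → ℤ) × ℤ

/-- The simple roots `α_i` as elements of `V̂`. -/
def αr (n : ℕ) (i : Fin (2 * n + 1)) : Lam n := (Pi.single i 1, 0)

/-- The element `∂` of `V̂`. -/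
def dr (n : ℕ) : Lam n := (0, 1)

/-- `α` reindexed by `ℕ` (with junk value `0` out of range). -/
def αn (n : ℕ) (t : ℕ) : Lam n := if h : t < 2 * n + 1 then αr n ⟨t, h⟩ else 0

/-- `δ̂ = α_0 + 2Σ_{t=1}^{N−1} α_t + α_N`. -/
def hatδ (n : ℕ) : Lam n :=
  αn n 0 + (2 : ℤ) • (∑ t ∈ Finset.Icc 1 (2 * n - 1), αn n t) + αn n (2 * n)

/-- `ε`-coordinates of `α_i` : `α_0 = δ̂ − 2ε_1`, `α_i = ε_i − ε_{i+1}`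
(`1 ≤ i ≤ N−1`), `α_N = 2ε_N` (`ε`-indices 0-based). -/
def wVec (n : ℕ) (i : ℕ) : Fin (2 * n) → ℤ := fun t =>
  if i = 0 then (if (t : ℕ) = 0 then -2 else 0)
  else if i = 2 * n then (if (t : ℕ) = 2 * n - 1 then 2 else 0)
  else (if (t : ℕ) = i - 1 then 1 else 0) - (if (t : ℕ) = i then 1 else 0)

/-- The bilinear-form values `(α_i, α_j)`, from `(ε_s,ε_t) = δ_{st} d̄_s`,
`d̄_s = 1` for `s ≤ n` and `−1` otherwise. -/
def Bfm (n : ℕ) (i j : ℕ) : ℤ :=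
  ∑ t : Fin (2 * n), (if (t : ℕ) < n then 1 else -1) * wVec n i t * wVec n j t

/-- `(ε_1, α_i)`. -/
def eps1dot (n : ℕ) (i : ℕ) : ℤ :=
  ∑ t : Fin (2 * n), (if (t : ℕ) < n then 1 else -1)
    * (if (t : ℕ) = 0 then 1 else 0) * wVec n i t

section Defs

variable (K : Type) [Field K] (n : ℕ)

/-- The free algebra on the generators. -/
abbrev FA : Type := FreeAlgebra K (QGen (Lam n) (Fin (2 * n + 1)))

def fK (a : Lam n) : FA K n := FreeAlgebra.ι K (QGen.Kg a)
def fL (a : Lam n) : FA K n := FreeAlgebra.ι K (QGen.Lg a)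
def fE (i : Fin (2 * n + 1)) : FA K n := FreeAlgebra.ι K (QGen.Eg i)
def fF (i : Fin (2 * n + 1)) : FA K n := FreeAlgebra.ι K (QGen.Fg i)

variable (χ : Lam n → Lam n → Kˣ)

/-- The `q`-bracket `⌊X,Y⌋ = XY − χ(μ,λ)⁻¹ YX` for `X` of degree `λ`, `Y` of
degree `μ` (free-algebra version, `E`-side). -/
def fbrE (lam mu : Lam n) (X Y : FA K n) : FA K n :=
  X * Y - ((((χ mu lam)⁻¹ : Kˣ) : K)) • (Y * X)

/-- The corresponding bracket on the `F`-side: the coefficient `χ(μ,λ)⁻¹` is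
replaced by `χ(λ,μ)⁻¹`. -/
def fbrF (lam mu : Lam n) (X Y : FA K n) : FA K n :=
  X * Y - ((((χ lam mu)⁻¹ : Kˣ) : K)) • (Y * X)

/-- The defining relations of the quantum affine superalgebra `U^♮_χ` of
`sl^{(2)}(2n|2n)`: the relations of `Ũ_χ` together with the Serre-type
relations for the `E_i` and the `F_i`. -/
inductive NRel : FA K n → FA K n → Prop
  | K0 : NRel (fK K n 0) 1
  | L0 : NRel (fL K n 0) 1
  | KK (a b : Lam n) : NRel (fK K n a * fK K n b) (fK K n (a + b))
  | LL (a b : Lam n) : NRel (fL K n a * fL K n b) (fL K n (a + b))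
  | KL (a b : Lam n) : NRel (fK K n a * fL K n b) (fL K n b * fK K n a)
  | KE (a : Lam n) (i : Fin (2 * n + 1)) :
      NRel (fK K n a * fE K n i) ((χ a (αr n i) : K) • (fE K n i * fK K n a))
  | KF (a : Lam n) (i : Fin (2 * n + 1)) :
      NRel (fK K n a * fF K n i) ((((χ a (αr n i))⁻¹ : Kˣ) : K) • (fF K n i * fK K n a))
  | LE (a : Lam n) (i : Fin (2 * n + 1)) :
      NRel (fL K n a * fE K n i) ((((χ (αr n i) a)⁻¹ : Kˣ) : K) • (fE K n i * fL K n a))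
  | LF (a : Lam n) (i : Fin (2 * n + 1)) :
      NRel (fL K n a * fF K n i) ((χ (αr n i) a : K) • (fF K n i * fL K n a))
  | EFsame (i : Fin (2 * n + 1)) :
      NRel (fE K n i * fF K n i - fF K n i * fE K n i) (-fK K n (αr n i) + fL K n (αr n i))
  | EFne (i j : Fin (2 * n + 1)) (h : i ≠ j) :
      NRel (fE K n i * fF K n j - fF K n j * fE K n i) 0
  | SE1 (i j : Fin (2 * n + 1)) (h : Bfm n i j = 0) :
      NRel (fbrE K n χ (αr n i) (αr n j) (fE K n i) (fE K n j)) 0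
  | SE2 (i j : Fin (2 * n + 1)) (hne : i ≠ j) (h1 : -(2 * Bfm n i j) = Bfm n i i)
      (h2 : Bfm n i i ≠ 0) :
      NRel (fbrE K n χ (αr n i) (αr n i + αr n j) (fE K n i)
        (fbrE K n χ (αr n i) (αr n j) (fE K n i) (fE K n j))) 0
  | SE3 (i j : Fin (2 * n + 1)) (hne : i ≠ j) (h1 : -(Bfm n i j) = Bfm n i i)
      (h2 : Bfm n i i ≠ 0) :
      NRel (fbrE K n χ (αr n i) (αr n i + (αr n i + αr n j)) (fE K n i)
        (fbrE K n χ (αr n i) (αr n i + αr n j) (fE K n i)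
          (fbrE K n χ (αr n i) (αr n j) (fE K n i) (fE K n j)))) 0
  | SE4 (i j k : Fin (2 * n + 1)) (h1 : i ≠ j) (h2 : j ≠ k) (h3 : k ≠ i)
      (h4 : Bfm n i i = 0) (h5 : Bfm n j k = 0)
      (h6 : -(Bfm n i j) = Bfm n i k) (h7 : Bfm n i k ≠ 0) :
      NRel (fbrE K n χ (αr n i + αr n j) (αr n i + αr n k)
        (fbrE K n χ (αr n i) (αr n j) (fE K n i) (fE K n j))
        (fbrE K n χ (αr n i) (αr n k) (fE K n i) (fE K n k))) 0
  | SF1 (i j : Fin (2 * n + 1)) (h : Bfm n i j = 0) :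
      NRel (fbrF K n χ (αr n i) (αr n j) (fF K n i) (fF K n j)) 0
  | SF2 (i j : Fin (2 * n + 1)) (hne : i ≠ j) (h1 : -(2 * Bfm n i j) = Bfm n i i)
      (h2 : Bfm n i i ≠ 0) :
      NRel (fbrF K n χ (αr n i) (αr n i + αr n j) (fF K n i)
        (fbrF K n χ (αr n i) (αr n j) (fF K n i) (fF K n j))) 0
  | SF3 (i j : Fin (2 * n + 1)) (hne : i ≠ j) (h1 : -(Bfm n i j) = Bfm n i i)
      (h2 : Bfm n i i ≠ 0) :
      NRel (fbrF K n χ (αr n i) (αr n i + (αr n i + αr n j)) (fF K n i)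
        (fbrF K n χ (αr n i) (αr n i + αr n j) (fF K n i)
          (fbrF K n χ (αr n i) (αr n j) (fF K n i) (fF K n j)))) 0
  | SF4 (i j k : Fin (2 * n + 1)) (h1 : i ≠ j) (h2 : j ≠ k) (h3 : k ≠ i)
      (h4 : Bfm n i i = 0) (h5 : Bfm n j k = 0)
      (h6 : -(Bfm n i j) = Bfm n i k) (h7 : Bfm n i k ≠ 0) :
      NRel (fbrF K n χ (αr n i + αr n j) (αr n i + αr n k)
        (fbrF K n χ (αr n i) (αr n j) (fF K n i) (fF K n j))
        (fbrF K n χ (αr n i) (αr n k) (fF K n i) (fF K n k))) 0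

/-- The quantum affine superalgebra `U^♮_χ` of `sl^{(2)}(2n|2n)`. -/
abbrev Unat : Type := RingQuot (NRel K n χ)

def uK (a : Lam n) : Unat K n χ := RingQuot.mkAlgHom K (NRel K n χ) (fK K n a)
def uL (a : Lam n) : Unat K n χ := RingQuot.mkAlgHom K (NRel K n χ) (fL K n a)
def uE (i : Fin (2 * n + 1)) : Unat K n χ := RingQuot.mkAlgHom K (NRel K n χ) (fE K n i)
def uF (i : Fin (2 * n + 1)) : Unat K n χ := RingQuot.mkAlgHom K (NRel K n χ) (fF K n i)

/-- `E` reindexed by `ℕ` (junk value `0` out of range). -/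
def uEn (t : ℕ) : Unat K n χ := if h : t < 2 * n + 1 then uE K n χ ⟨t, h⟩ else 0

/-- The `q`-bracket in `U^♮_χ` (for `X` of degree `λ` and `Y` of degree `μ`). -/
def ubrE (lam mu : Lam n) (X Y : Unat K n χ) : Unat K n χ :=
  X * Y - ((((χ mu lam)⁻¹ : Kˣ) : K)) • (Y * X)

/-- `deg B_i = Σ_{t=i+1}^{N−i−1} α_t`. -/
def degB (i : ℕ) : Lam n := ∑ t ∈ Finset.Icc (i + 1) (2 * n - i - 1), αn n t

/-- `C j := B_{n−1−j}` : `C 0 = E_n`,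
`C (j+1) = ⌊E_{n+j+1}, ⌊C j, E_{n−1−j}⌋⌋`. -/
def Cseq : ℕ → Unat K n χ
  | 0 => uEn K n χ n
  | j + 1 =>
      ubrE K n χ (αn n (n + j + 1)) (degB n (n - 1 - j) + αn n (n - 1 - j))
        (uEn K n χ (n + j + 1))
        (ubrE K n χ (degB n (n - 1 - j)) (αn n (n - 1 - j)) (Cseq j) (uEn K n χ (n - 1 - j)))

/-- `B_i` (for `i ∈ {0,…,n−1}`): `B_{n−1} = E_n`,
`B_i = ⌊E_{N−i−1}, ⌊B_{i+1}, E_{i+1}⌋⌋`. -/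
def Bseq (i : ℕ) : Unat K n χ := Cseq K n χ (n - 1 - i)

/-- `B_{−1} := ⌊E_N, ⌊B_0, E_0⌋⌋`. -/
def Bm1 : Unat K n χ :=
  ubrE K n χ (αn n (2 * n)) (degB n 0 + αn n 0) (uEn K n χ (2 * n))
    (ubrE K n χ (degB n 0) (αn n 0) (Bseq K n χ 0) (uEn K n χ 0))

/-- `deg B_{−1} = α_N + Σ_{t=1}^{N−1} α_t + α_0`. -/
def degBm1 : Lam n := αn n (2 * n) + degB n 0 + αn n 0

/-- `deg A_i = deg B_{−1} + Σ_{t=1}^{i} α_t + Σ_{t=N−i}^{N−1} α_t`. -/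
def degA (i : ℕ) : Lam n :=
  degBm1 n + (∑ t ∈ Finset.Icc 1 i, αn n t)
    + ∑ t ∈ Finset.Icc (2 * n - i) (2 * n - 1), αn n t

/-- `A_0 = B_{−1}`, `A_i = ⌊E_{N−i}, ⌊A_{i−1}, E_i⌋⌋`. -/
def Aseq : ℕ → Unat K n χ
  | 0 => Bm1 K n χ
  | i + 1 =>
      ubrE K n χ (αn n (2 * n - i - 1)) (degA n i + αn n (i + 1))
        (uEn K n χ (2 * n - i - 1))
        (ubrE K n χ (degA n i) (αn n (i + 1)) (Aseq i) (uEn K n χ (i + 1)))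

/-- The scalars `a_i`. -/
def aScal : ℕ → K
  | 0 => 1
  | i + 1 =>
      aScal i * (χ (hatδ n) (αn n (2 * n - i - 1)) : K)
        * (χ (-αn n (i + 1)) (∑ t ∈ Finset.Icc (i + 2) (2 * n - i - 2), αn n t) : K)
        * (χ (∑ t ∈ Finset.Icc (i + 1) (2 * n - i - 2), αn n t) (-αn n (2 * n - i - 1)) : K)

/-- The element `Z = Σ_{i=0}^{n−1} a_i ⌊A_i, B_i⌋` of `U^♮_χ`. -/
def Zel : Unat K n χ :=
  ∑ i ∈ Finset.range n,
    aScal K n χ i • ubrE K n χ (degA n i) (degB n i) (Aseq K n χ i) (Bseq K n χ i)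

end Defs


set_option linter.unusedSimpArgs false

section Raw
variable {K A : Type} [Field K] [Ring A] [Algebra K A]

theorem raw_L (x y z : A) (a p r r' t : K) (hr : r ≠ 0) (ht : t ≠ 0) (hrt : r' = (r * t)⁻¹)
    (h1t : 1 + t ≠ 0)
    (hxz : x * z - a • (z * x) = 0)
    (hx : (x * y - p • (y * x)) * y - (p * t) • (y * (x * y - p • (y * x))) = 0)
    (hz : (z * y - r • (y * z)) * y - (r * t) • (y * (z * y - r • (y * z))) = 0) :
    ((x * y - p • (y * x)) * z - (a * r') • (z * (x * y - p • (y * x)))) * y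
      - (p * t * r) • (y * ((x * y - p • (y * x)) * z
        - (a * r') • (z * (x * y - p • (y * x))))) = 0 := by
  subst hrt
  have e1 := congrArg (fun u => u * y * y - (p * r * (1 + t)) • (y * u * y)
    + (p * r * p * r * t) • (y * y * u)) hxz
  have e2 := congrArg (fun u => x * u - (a * p ^ 2) • (u * x)) hz
  have e3 := congrArg (fun u => r ^ 2 • (u * z) - a • (z * u)) hx
  have e4 := congrArg (fun u => r ^ 2 • (u * z) - (a * t⁻¹) • (z * u)) hx
  have : ((1 + t) * r) • (((x * y - p • (y * x)) * z
        - (a * (r * t)⁻¹) • (z * (x * y - p • (y * x)))) * y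
      - (p * t * r) • (y * ((x * y - p • (y * x)) * z
        - (a * (r * t)⁻¹) • (z * (x * y - p • (y * x)))))) = 0 := by
    simp only [smul_sub, mul_sub, sub_mul, smul_mul_assoc, mul_smul_comm, smul_smul, mul_assoc,
      mul_zero, zero_mul, smul_zero, sub_zero, add_zero] at *
    linear_combination (norm := skip) e1 - e2 - e3 + (1+t) • e4
    match_scalars <;> field_simp <;> ring
  exact (smul_eq_zero.mp this).resolve_left (mul_ne_zero h1t hr)

theorem raw_L' (x y z : A) (a p r r' t : K) (hr : r ≠ 0) (ht : t ≠ 0) (hrt : r' = (r * t)⁻¹)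
    (h1t : 1 + t ≠ 0)
    (hxz : z * x - a • (x * z) = 0)
    (hx : y * (y * x - p • (x * y)) - (p * t) • ((y * x - p • (x * y)) * y) = 0)
    (hz : y * (y * z - r • (z * y)) - (r * t) • ((y * z - r • (z * y)) * y) = 0) :
    y * (z * (y * x - p • (x * y)) - (a * r') • ((y * x - p • (x * y)) * z))
      - (p * t * r) • ((z * (y * x - p • (x * y))
        - (a * r') • ((y * x - p • (x * y)) * z)) * y) = 0 :=
  congrArg MulOpposite.unop (raw_L (A := Aᵐᵒᵖ) (MulOpposite.op x) (MulOpposite.op y)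
    (MulOpposite.op z) a p r r' t hr ht hrt h1t (congrArg MulOpposite.op hxz)
    (congrArg MulOpposite.op hx) (congrArg MulOpposite.op hz))

theorem raw_C (x y z : A) (a p r r' t : K) (hr : r ≠ 0) (ht : t ≠ 0)
    (hrt : r' = (r * t * t)⁻¹) (h1t : 1 + t + t * t ≠ 0)
    (hxz : x * z - a • (z * x) = 0) (dx dz ddz w dw : A)
    (hdx : dx = x * y - p • (y * x))
    (hx : dx * y - (p * t) • (y * dx) = 0)
    (hdz : dz = z * y - r • (y * z))
    (hddz : ddz = dz * y - (r * t) • (y * dz))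
    (hz : ddz * y - (r * t * t) • (y * ddz) = 0)
    (hw : w = dx * z - (a * r') • (z * dx))
    (hdw : dw = w * y - (p * t * r) • (y * w)) :
    dw * y - (p * t * r * t) • (y * dw) = 0 := by
  subst hrt
  have e1 := congrArg (fun u => u * y * y * y - (p * r * (1 + t + t * t)) • (y * u * y * y)
    + (p * r * p * r * t * (1 + t + t * t)) • (y * y * u * y)
    - (p * r * p * r * p * r * t * t * t) • (y * y * y * u)) hxz
  have e2 := congrArg (fun u => x * u - (a * p ^ 3) • (u * x)) hz
  have e3 := congrArg (fun u => ((1 + t + t * t) * (r * (1 + t) * r - r ^ 2)) • (u * dz)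
    + (a * p * (1 + t + t * t) * (1 - t⁻¹ * (1 + t))) • (dz * u)
    + ((1 + t + t * t) * r ^ 3 - r ^ 3) • ((u * y - (p * t * t) • (y * u)) * z)
    + (a - a * (t⁻¹) ^ 2 * (1 + t + t * t)) • (z * (u * y - (p * t * t) • (y * u)))) hx
  have : ((1 + t + t * t) * r) • (dw * y - (p * t * r * t) • (y * dw)) = 0 := by
    subst hdw hw hddz hdz hdx
    simp only [smul_sub, mul_sub, sub_mul, smul_mul_assoc, mul_smul_comm, smul_smul, mul_assoc,
      mul_zero, zero_mul, smul_zero, sub_zero, add_zero] at *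
    linear_combination (norm := skip) e1 - e2 + e3
    match_scalars <;> field_simp <;> ring
  exact (smul_eq_zero.mp this).resolve_left (mul_ne_zero h1t hr)

theorem raw_C' (x y z : A) (a p r r' t : K) (hr : r ≠ 0) (ht : t ≠ 0)
    (hrt : r' = (r * t * t)⁻¹) (h1t : 1 + t + t * t ≠ 0)
    (hxz : z * x - a • (x * z) = 0) (dx dz ddz w dw : A)
    (hdx : dx = y * x - p • (x * y))
    (hx : y * dx - (p * t) • (dx * y) = 0)
    (hdz : dz = y * z - r • (z * y))
    (hddz : ddz = y * dz - (r * t) • (dz * y))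
    (hz : y * ddz - (r * t * t) • (ddz * y) = 0)
    (hw : w = z * dx - (a * r') • (dx * z))
    (hdw : dw = y * w - (p * t * r) • (w * y)) :
    y * dw - (p * t * r * t) • (dw * y) = 0 :=
  congrArg MulOpposite.unop (raw_C (A := Aᵐᵒᵖ) (MulOpposite.op x) (MulOpposite.op y)
    (MulOpposite.op z) a p r r' t hr ht hrt h1t (congrArg MulOpposite.op hxz)
    (MulOpposite.op dx) (MulOpposite.op dz) (MulOpposite.op ddz) (MulOpposite.op w)
    (MulOpposite.op dw) (congrArg MulOpposite.op hdx)
    (congrArg MulOpposite.op hx) (congrArg MulOpposite.op hdz) (congrArg MulOpposite.op hddz)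
    (congrArg MulOpposite.op hz) (congrArg MulOpposite.op hw) (congrArg MulOpposite.op hdw))

/-- reversing the Serre relation -/
theorem raw_S (x w : A) (p p' t : K) (hp : p ≠ 0) (ht : t ≠ 0) (hp' : p' = (p * t)⁻¹)
    (h : w * (w * x - p • (x * w)) - (t * p) • ((w * x - p • (x * w)) * w) = 0) :
    (x * w - p' • (w * x)) * w - (p' * t) • (w * (x * w - p' • (w * x))) = 0 := by
  subst hp'
  have e := congrArg (fun u => (p * p * t)⁻¹ • u) h
  simp only [smul_sub, mul_sub, sub_mul, smul_mul_assoc, mul_smul_comm, smul_smul, mul_assoc,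
      mul_zero, zero_mul, smul_zero, sub_zero, add_zero] at *
  linear_combination (norm := skip) e
  match_scalars <;> field_simp <;> ring

theorem raw_S3 (x w : A) (p p' t : K) (hp : p ≠ 0) (ht : t ≠ 0) (hp' : p' = (p * t * t)⁻¹)
    (d dd : A) (hd : d = w * x - p • (x * w)) (hdd : dd = w * d - (t * p) • (d * w))
    (h : w * dd - (t * (t * p)) • (dd * w) = 0)
    (e ee : A) (he : e = x * w - p' • (w * x)) (hee : ee = e * w - (p' * t) • (w * e)) :
    ee * w - (p' * t * t) • (w * ee) = 0 := by
  subst hp' hd hdd hee he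
  have e := congrArg (fun u => (-(p * p * p * t * t * t)⁻¹) • u) h
  simp only [smul_sub, mul_sub, sub_mul, smul_mul_assoc, mul_smul_comm, smul_smul, mul_assoc,
      mul_zero, zero_mul, smul_zero, sub_zero, add_zero] at *
  linear_combination (norm := skip) e
  match_scalars <;> field_simp <;> ring

/-- the odd case -/
theorem raw_O (x y z : A) (cxy cyx cyz czy cxz czx : K)
    (h0x : cyx ≠ 0) (h0z : czx ≠ 0) (h0y : cyz ≠ 0)
    (h1 : cxz = czx⁻¹) (h2 : czy = (cxy * cyx * cyz)⁻¹) (h0 : cxy ≠ 0)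
    (hyy : y * y = 0) (hxz : x * z - cxz • (z * x) = 0)
    (h : (y * z - cyz • (z * y)) * (y * x - cyx • (x * y))
      - (-1 * cyx * (czy * czx)) • ((y * x - cyx • (x * y)) * (y * z - cyz • (z * y))) = 0) :
    (x * (y * z - cyz • (z * y)) - (cxy * cxz) • ((y * z - cyz • (z * y)) * x)) * y
      - (cxy * (-1 * czy)) • (y * (x * (y * z - cyz • (z * y))
        - (cxy * cxz) • ((y * z - cyz • (z * y)) * x))) = 0 := by
  subst h1 h2
  have hyy' : ∀ u : A, y * (y * u) = 0 := fun u => by rw [← mul_assoc, hyy, zero_mul]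
  have e := congrArg (fun u => (czx⁻¹ * cxy * cyx⁻¹) • u) h
  simp only [smul_sub, mul_sub, sub_mul, smul_mul_assoc, mul_smul_comm, smul_smul, mul_assoc,
      mul_zero, zero_mul, smul_zero, sub_zero, zero_sub, add_zero, hyy, hyy'] at *
  linear_combination (norm := skip) e
  match_scalars <;> field_simp <;> ring
end Raw

section Abs
variable {K A Λ : Type} [Field K] [Ring A] [Algebra K A] [AddCommGroup Λ]

structure BC (c : Λ → Λ → K) : Prop where
  add_left : ∀ a b d, c (a + b) d = c a d * c b d
  add_right : ∀ a b d, c a (b + d) = c a b * c a d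
  ne : ∀ a b, c a b ≠ 0

def pbr (c : Λ → Λ → K) (X Y : Λ × A) : Λ × A :=
  (X.1 + Y.1, X.2 * Y.2 - c X.1 Y.1 • (Y.2 * X.2))

def PZ (c : Λ → Λ → K) (X Y : Λ × A) : Prop := (pbr c X Y).2 = 0

theorem PZ.sq_zero [CharZero K] {c : Λ → Λ → K} {y : Λ × A} (h : PZ c y y)
    (ht : c y.1 y.1 = -1) : y.2 * y.2 = 0 := by
  unfold PZ pbr at h
  dsimp only at h
  rw [ht, neg_smul, one_smul, sub_neg_eq_add] at h
  have h2 : (2 : K) • (y.2 * y.2) = 0 := by rw [two_smul]; exact h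
  exact (smul_eq_zero.mp h2).resolve_left two_ne_zero

def PCom (c : Λ → Λ → K) (X Y : Λ × A) : Prop := PZ c X Y ∧ c X.1 Y.1 * c Y.1 X.1 = 1

def PSer (c : Λ → Λ → K) (X w : Λ × A) : Prop :=
  PZ c w (pbr c w X) ∧ c X.1 w.1 * c w.1 X.1 * c w.1 w.1 = 1

def PSer3 (c : Λ → Λ → K) (X w : Λ × A) : Prop :=
  PZ c w (pbr c w (pbr c w X)) ∧ c X.1 w.1 * c w.1 X.1 * c w.1 w.1 * c w.1 w.1 = 1

variable {c : Λ → Λ → K}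

theorem PCom.symm (hc : BC c) {X Y : Λ × A} (h : PCom c X Y) : PCom c Y X := by
  obtain ⟨h1, h2⟩ := h
  refine ⟨?_, by rw [mul_comm]; exact h2⟩
  simp only [PZ, pbr] at *
  have : c Y.1 X.1 = (c X.1 Y.1)⁻¹ := eq_inv_of_mul_eq_one_right h2
  have h3 := hc.ne X.1 Y.1
  rw [sub_eq_zero.mp h1, smul_smul, this, inv_mul_cancel₀ h3, one_smul, sub_self]

theorem PZ.br_left (hc : BC c) {X Y w : Λ × A} (h1 : PZ c X w) (h2 : PZ c Y w) :
    PZ c (pbr c X Y) w := by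
  simp only [PZ, pbr, hc.add_left] at *
  have e1 := congrArg (fun u => (c Y.1 w.1) • (u * Y.2) - (c X.1 Y.1) • (Y.2 * u)) h1
  have e2 := congrArg (fun u => X.2 * u - (c X.1 Y.1 * c X.1 w.1) • (u * X.2)) h2
  simp only [smul_sub, mul_sub, sub_mul, smul_mul_assoc, mul_smul_comm, smul_smul, mul_assoc,
      mul_zero, zero_mul, smul_zero, sub_zero, add_zero] at *
  linear_combination (norm := skip) e1 + e2
  match_scalars <;> ring

theorem PZ.br_right (hc : BC c) {X Y w : Λ × A} (h1 : PZ c w X) (h2 : PZ c w Y) :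
    PZ c w (pbr c X Y) := by
  simp only [PZ, pbr, hc.add_right] at *
  have e1 := congrArg (fun u => (u * Y.2) - (c X.1 Y.1 * c w.1 Y.1) • (Y.2 * u)) h1
  have e2 := congrArg (fun u => c w.1 X.1 • (X.2 * u) - (c X.1 Y.1) • (u * X.2)) h2
  simp only [smul_sub, mul_sub, sub_mul, smul_mul_assoc, mul_smul_comm, smul_smul, mul_assoc,
      mul_zero, zero_mul, smul_zero, sub_zero, add_zero] at *
  linear_combination (norm := skip) e1 + e2
  match_scalars <;> ring

theorem PCom.br (hc : BC c) {X Y w : Λ × A} (h1 : PCom c X w) (h2 : PCom c Y w) :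
    PCom c (pbr c X Y) w := by
  refine ⟨PZ.br_left hc h1.1 h2.1, ?_⟩
  simp only [pbr, hc.add_left, hc.add_right]
  have e1 := h1.2
  have e2 := h2.2
  linear_combination c Y.1 w.1 * c w.1 Y.1 * e1 + e2

theorem pbr_assoc (hc : BC c) {X Y w : Λ × A} (h : PZ c X w) :
    pbr c (pbr c X Y) w = pbr c X (pbr c Y w) := by
  refine Prod.ext (add_assoc _ _ _) ?_
  simp only [PZ, pbr, hc.add_left, hc.add_right] at *
  have e1 := congrArg (fun u => (c Y.1 w.1) • (u * Y.2) - (c X.1 Y.1) • (Y.2 * u)) h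
  simp only [smul_sub, mul_sub, sub_mul, smul_mul_assoc, mul_smul_comm, smul_smul, mul_assoc,
      mul_zero, zero_mul, smul_zero, sub_zero, add_zero] at *
  linear_combination (norm := skip) e1
  match_scalars <;> ring

/-- the other associativity: `[w,[X,Y]] = [[w,X],Y]` when `[w,Y]=0`. -/
theorem pbr_assoc' (hc : BC c) {X Y w : Λ × A} (h : PZ c w Y) :
    pbr c w (pbr c X Y) = pbr c (pbr c w X) Y := by
  rw [pbr_assoc hc h]

theorem PSer.right (hc : BC c) {X w : Λ × A} (h : PSer c X w) : PZ c (pbr c X w) w := by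
  obtain ⟨h1, h2⟩ := h
  simp only [PZ, pbr, hc.add_left, hc.add_right] at *
  refine raw_S X.2 w.2 (c w.1 X.1) (c X.1 w.1) (c w.1 w.1) (hc.ne _ _) (hc.ne _ _) ?_ h1
  exact eq_inv_of_mul_eq_one_left (by rw [← mul_assoc]; exact h2)

theorem PSer3.right (hc : BC c) {X w : Λ × A} (h : PSer3 c X w) :
    PZ c (pbr c (pbr c X w) w) w := by
  obtain ⟨h1, h2⟩ := h
  simp only [PZ, pbr, hc.add_left, hc.add_right] at *
  refine raw_S3 X.2 w.2 (c w.1 X.1) (c X.1 w.1) (c w.1 w.1) (hc.ne _ _) (hc.ne _ _) ?_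
    _ _ rfl rfl h1 _ _ rfl rfl
  exact eq_inv_of_mul_eq_one_left (by rw [← mul_assoc, ← mul_assoc]; exact h2)

theorem PSer.br1 (hc : BC c) {X Y w : Λ × A} (h1 : PCom c X w) (h2 : PSer c Y w) :
    PSer c (pbr c X Y) w := by
  refine ⟨?_, ?_⟩
  · have e1 := (h1.symm hc).1
    have e2 := h2.1
    simp only [PZ, pbr, hc.add_left, hc.add_right] at *
    have e1' := sub_eq_zero.mp e1
    have e1'' : ∀ u : A, w.2 * (X.2 * u) = c w.1 X.1 • (X.2 * (w.2 * u)) := fun u => by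
      rw [← mul_assoc, e1', smul_mul_assoc, mul_assoc]
    have e3 := congrArg (fun u => (c w.1 X.1) ^ 2 • (X.2 * u) - (c X.1 Y.1) • (u * X.2)) e2
    simp only [smul_sub, mul_sub, sub_mul, smul_mul_assoc, mul_smul_comm, smul_smul, mul_assoc,
      mul_zero, zero_mul, smul_zero, sub_zero, add_zero, e1', e1''] at e3 ⊢
    linear_combination (norm := skip) e3
    match_scalars <;> ring
  · simp only [pbr, hc.add_left, hc.add_right]
    have e1 := h1.2
    have e2 := h2.2
    linear_combination c Y.1 w.1 * c w.1 Y.1 * c w.1 w.1 * e1 + e2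

theorem PSer.br2 (hc : BC c) {X Y w : Λ × A} (h2 : PSer c X w) (h1 : PCom c Y w) :
    PSer c (pbr c X Y) w := by
  refine ⟨?_, ?_⟩
  · rw [pbr_assoc' hc (h1.symm hc).1]
    exact PZ.br_right hc h2.1 (h1.symm hc).1
  · simp only [pbr, hc.add_left, hc.add_right]
    have e1 := h1.2
    have e2 := h2.2
    linear_combination c X.1 w.1 * c w.1 X.1 * c w.1 w.1 * e1 + e2

theorem ser_aux (hc : BC c) {x y z : Λ × A} (hx : PSer c x y) (hz : PSer c z y) :
    c (x.1 + (y.1 + z.1)) y.1 * c y.1 (x.1 + (y.1 + z.1)) = 1 := by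
  simp only [hc.add_left, hc.add_right]
  have e1 := hx.2
  have e2 := hz.2
  linear_combination c z.1 y.1 * c y.1 z.1 * c y.1 y.1 * e1 + e2

theorem PL (hc : BC c) {x y z : Λ × A} (hxz : PZ c x z) (hx : PSer c x y) (hz : PSer c z y)
    (ht : 1 + c y.1 y.1 ≠ 0) : PCom c (pbr c (pbr c x y) z) y := by
  refine ⟨?_, ?_⟩
  · have e1 := hx.right hc
    have e2 := hz.right hc
    simp only [PZ, pbr, hc.add_left, hc.add_right] at *
    exact raw_L x.2 y.2 z.2 (c x.1 z.1) (c x.1 y.1) (c z.1 y.1) (c y.1 z.1) (c y.1 y.1)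
      (hc.ne _ _) (hc.ne _ _)
      (eq_inv_of_mul_eq_one_left (by rw [← hz.2]; ring)) ht hxz e1 e2
  · have := ser_aux hc hx hz
    simpa only [pbr, add_assoc] using this

theorem PL' (hc : BC c) {x y z : Λ × A} (hxz : PZ c z x) (hx : PSer c x y) (hz : PSer c z y)
    (ht : 1 + c y.1 y.1 ≠ 0) : PCom c (pbr c z (pbr c y x)) y := by
  refine PCom.symm hc ⟨?_, ?_⟩
  · have e1 := hx.1
    have e2 := hz.1
    simp only [PZ, pbr, hc.add_left, hc.add_right] at *
    have := raw_L' x.2 y.2 z.2 (c z.1 x.1) (c y.1 x.1) (c y.1 z.1) (c z.1 y.1) (c y.1 y.1)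
      (hc.ne _ _) (hc.ne _ _)
      (eq_inv_of_mul_eq_one_left (by rw [← hz.2]; ring)) ht hxz
      (by rw [mul_comm (c y.1 x.1)]; exact e1) (by rw [mul_comm (c y.1 z.1)]; exact e2)
    rw [mul_comm (c z.1 y.1), show c y.1 z.1 * (c y.1 y.1 * c y.1 x.1)
      = c y.1 x.1 * c y.1 y.1 * c y.1 z.1 by ring]
    exact this
  · have := ser_aux hc hx hz
    rw [mul_comm] at this
    simpa only [pbr, add_comm, add_left_comm, add_assoc] using this

theorem ser3_aux (hc : BC c) {x y z : Λ × A} (hx : PSer c x y) (hz : PSer3 c z y) :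
    c (x.1 + (y.1 + z.1)) y.1 * c y.1 (x.1 + (y.1 + z.1)) * c y.1 y.1 = 1 := by
  simp only [hc.add_left, hc.add_right]
  have e1 := hx.2
  have e2 := hz.2
  linear_combination c z.1 y.1 * c y.1 z.1 * c y.1 y.1 * c y.1 y.1 * e1 + e2

theorem PC' (hc : BC c) {x y z : Λ × A} (hxz : PZ c z x) (hx : PSer c x y) (hz : PSer3 c z y)
    (ht : 1 + c y.1 y.1 + c y.1 y.1 * c y.1 y.1 ≠ 0) :
    PSer c (pbr c z (pbr c y x)) y := by
  refine ⟨?_, ?_⟩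
  · have e1 := hx.1
    have e2 := hz.1
    simp only [PZ, pbr, hc.add_left, hc.add_right] at *
    have := raw_C' x.2 y.2 z.2 (c z.1 x.1) (c y.1 x.1) (c y.1 z.1) (c z.1 y.1) (c y.1 y.1)
      (hc.ne _ _) (hc.ne _ _)
      (eq_inv_of_mul_eq_one_left (by rw [← hz.2]; ring)) ht hxz _ _ _ _ _ rfl
      (by rw [mul_comm (c y.1 x.1)]; exact e1) rfl rfl
      (by
        rw [show c y.1 z.1 * c y.1 y.1 * c y.1 y.1 = c y.1 y.1 * (c y.1 y.1 * c y.1 z.1) by ring,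
          mul_comm (c y.1 z.1)]
        exact e2) rfl rfl
    rw [mul_comm (c z.1 y.1), show c y.1 z.1 * (c y.1 y.1 * c y.1 x.1)
      = c y.1 x.1 * c y.1 y.1 * c y.1 z.1 by ring, mul_comm (c y.1 y.1) (_ * _)]
    exact this
  · have := ser3_aux hc hx hz
    simpa only [pbr, add_comm, add_left_comm, add_assoc] using this

/-- Converse reversal. -/
theorem PSer.of_right (hc : BC c) {X w : Λ × A} (h : PZ c (pbr c X w) w)
    (h2 : c X.1 w.1 * c w.1 X.1 * c w.1 w.1 = 1) : PSer c X w := by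
  refine ⟨?_, h2⟩
  simp only [PZ, pbr, hc.add_left, hc.add_right] at *
  have h' := congrArg MulOpposite.op h
  have := raw_S (A := Aᵐᵒᵖ) (MulOpposite.op X.2) (MulOpposite.op w.2) (c X.1 w.1) (c w.1 X.1)
    (c w.1 w.1) (hc.ne _ _) (hc.ne _ _)
    (eq_inv_of_mul_eq_one_left (by rw [← h2]; ring))
    (by rw [mul_comm (c w.1 w.1)]; exact h')
  rw [mul_comm (c w.1 w.1)]
  exact congrArg MulOpposite.unop this

theorem PC (hc : BC c) {x y z : Λ × A} (hxz : PZ c x z) (hx : PSer c x y) (hz : PSer3 c z y)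
    (ht : 1 + c y.1 y.1 + c y.1 y.1 * c y.1 y.1 ≠ 0) :
    PSer c (pbr c (pbr c x y) z) y := by
  refine PSer.of_right hc ?_ ?_
  · have e1 := hx.right hc
    have e2 := hz.right hc
    simp only [PZ, pbr, hc.add_left, hc.add_right] at *
    exact raw_C x.2 y.2 z.2 (c x.1 z.1) (c x.1 y.1) (c z.1 y.1) (c y.1 z.1) (c y.1 y.1)
      (hc.ne _ _) (hc.ne _ _)
      (eq_inv_of_mul_eq_one_left (by rw [← hz.2]; ring)) ht hxz _ _ _ _ _ rfl e1 rfl rfl e2 rfl rfl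
  · have := ser3_aux hc hx hz
    simpa only [pbr, add_assoc] using this

theorem PO (hc : BC c) {x y z : Λ × A} (hxz : PCom c x z) (hyy : y.2 * y.2 = 0)
    (ht : c y.1 y.1 = -1) (hs : c x.1 y.1 * c y.1 x.1 * (c y.1 z.1 * c z.1 y.1) = 1)
    (h : PZ c (pbr c y z) (pbr c y x)) : PCom c (pbr c x (pbr c y z)) y := by
  obtain ⟨h1, h2⟩ := hxz
  refine ⟨?_, ?_⟩
  · simp only [PZ, pbr, hc.add_left, hc.add_right, ht] at *
    exact raw_O x.2 y.2 z.2 (c x.1 y.1) (c y.1 x.1) (c y.1 z.1) (c z.1 y.1) (c x.1 z.1) (c z.1 x.1)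
      (hc.ne _ _) (hc.ne _ _) (hc.ne _ _) (eq_inv_of_mul_eq_one_left h2)
      (eq_inv_of_mul_eq_one_left (by rw [← hs]; ring)) (hc.ne _ _) hyy h1 h
  · simp only [pbr, hc.add_left, hc.add_right, ht]
    linear_combination hs
end Abs

section Seq
variable {K A Λ : Type} [Field K] [Ring A] [Algebra K A] [AddCommGroup Λ]

structure Gens (c : Λ → Λ → K) (n : ℕ) (G : ℕ → Λ × A) : Prop where
  hn : 2 ≤ n
  hc : BC c
  com : ∀ i j, i ≤ 2 * n → j ≤ 2 * n → (i + 2 ≤ j ∨ j + 2 ≤ i) → PCom c (G i) (G j)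
  serL : ∀ i j, j = i + 1 → i < n → PSer c (G j) (G i)
  serL' : ∀ i j, j = i + 1 → 1 ≤ i → j < n → PSer c (G i) (G j)
  serR : ∀ i j, j = i + 1 → n ≤ i → j ≤ 2 * n → PSer c (G i) (G j)
  serR' : ∀ i j, j = i + 1 → n < i → j < 2 * n → PSer c (G j) (G i)
  ser3L : PSer3 c (G 0) (G 1)
  ser3R : ∀ i, i + 1 = 2 * n → PSer3 c (G (2 * n)) (G i)
  ne2 : ∀ i, i ≤ 2 * n → i ≠ n → 1 + c (G i).1 (G i).1 ≠ 0
  ne3 : ∀ i, i ≤ 2 * n → i ≠ n →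
    1 + c (G i).1 (G i).1 + c (G i).1 (G i).1 * c (G i).1 (G i).1 ≠ 0
  nil : PZ c (G n) (G n)
  odd : ∀ i, i + 1 = n → PCom c (pbr c (G (n + 1)) (pbr c (G n) (G i))) (G n)

def Cp (c : Λ → Λ → K) (n : ℕ) (G : ℕ → Λ × A) : ℕ → Λ × A
  | 0 => G n
  | k + 1 => pbr c (G (n + k + 1)) (pbr c (Cp c n G k) (G (n - 1 - k)))

def Ap (c : Λ → Λ → K) (n : ℕ) (G : ℕ → Λ × A) : ℕ → Λ × A
  | 0 => pbr c (G (2 * n)) (pbr c (Cp c n G (n - 1)) (G 0))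
  | i + 1 => pbr c (G (2 * n - i - 1)) (pbr c (Ap c n G i) (G (i + 1)))

structure CProp (c : Λ → Λ → K) (n : ℕ) (G : ℕ → Λ × A) (k : ℕ) : Prop where
  com : ∀ m, m ≤ 2 * n → m + k + 1 ≠ n → m + k ≠ n → m ≠ n + k → m ≠ n + k + 1 →
    PCom c (Cp c n G k) (G m)
  zl : ∀ m, 1 ≤ k → m + k = n → PZ c (Cp c n G k) (G m)
  zr : PZ c (G (n + k)) (Cp c n G k)
  sl : ∀ m, m + k + 1 = n → PSer c (Cp c n G k) (G m)
  sr : ∀ m, m = n + k + 1 → PSer c (Cp c n G k) (G m)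

structure AProp (c : Λ → Λ → K) (n : ℕ) (G : ℕ → Λ × A) (i : ℕ) : Prop where
  com : ∀ m, m ≤ 2 * n → m ≠ i → m ≠ i + 1 → m + i + 1 ≠ 2 * n → m + i ≠ 2 * n →
    PCom c (Ap c n G i) (G m)
  zl : PZ c (Ap c n G i) (G i)
  zr : ∀ m, m + i = 2 * n → PZ c (G m) (Ap c n G i)
  sl : i + 1 < n → PSer c (Ap c n G i) (G (i + 1))
  sr : ∀ m, i + 1 < n → m + i + 1 = 2 * n → PSer c (Ap c n G i) (G m)

variable {c : Λ → Λ → K} {n : ℕ} {G : ℕ → Λ × A}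

theorem cprop0 (h : Gens c n G) : CProp c n G 0 where
  com m h1 h2 h3 h4 h5 := h.com _ _ (by omega) h1 (by omega)
  zl m h1 := by omega
  zr := h.nil
  sl m hm := h.serL _ _ (by omega) (by omega)
  sr m hm := h.serR _ _ (by omega) (by omega) (by have := h.hn; omega)

theorem cprop_succ (h : Gens c n G) (k : ℕ) (hk : k + 1 < n) (ih : CProp c n G k)
    (ih' : ∀ k', k = k' + 1 → CProp c n G k') : CProp c n G (k + 1) where
  com m h1 h2 h3 h4 h5 := by
    have hc := h.hc
    by_cases hm : m + k = n ∨ m = n + k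
    · cases k with
      | zero =>
        obtain rfl : m = n := by omega
        exact h.odd (m - 1 - 0) (by have := h.hn; omega)
      | succ k =>
        have IH := ih' k rfl
        have hco : PCom c (G (n + k + 1)) (G (n - 1 - (k + 1))) :=
          h.com _ _ (by omega) (by omega) (by omega)
        have e : Cp c n G (k + 1 + 1) = pbr c (G (n + (k + 1) + 1)) (pbr c (G (n + k + 1))
            (pbr c (pbr c (Cp c n G k) (G (n - 1 - k))) (G (n - 1 - (k + 1))))) := by
          rw [Cp, Cp, pbr_assoc hc hco.1]
        rw [e]
        rcases hm with hm | hm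
        · obtain rfl : m = n - 1 - k := by omega
          refine PCom.br hc (h.com _ _ (by omega) (by omega) (by omega))
            (PCom.br hc (h.com _ _ (by omega) (by omega) (by omega)) ?_)
          exact PL hc (IH.com _ (by omega) (by omega) (by omega) (by omega) (by omega)).1
            (IH.sl _ (by omega)) (h.serL' _ _ (by omega) (by omega) (by omega))
            (h.ne2 _ (by omega) (by omega))
        · obtain rfl : m = n + k + 1 := by omega
          refine PL' hc ?_ ?_ (h.serR' _ _ (by omega) (by omega) (by omega))
            (h.ne2 _ (by omega) (by omega))
          · refine PZ.br_right hc (PZ.br_right hc ?_ ?_) ?_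
            · exact ((IH.com _ (by omega) (by omega) (by omega) (by omega) (by omega)).symm hc).1
            · exact (h.com _ _ (by omega) (by omega) (by omega)).1
            · exact (h.com _ _ (by omega) (by omega) (by omega)).1
          · exact PSer.br2 hc (PSer.br2 hc (IH.sr _ (by omega))
              (h.com _ _ (by omega) (by omega) (by omega)))
              (h.com _ _ (by omega) (by omega) (by omega))
    · exact PCom.br hc (h.com _ _ (by omega) (by omega) (by omega))
        (PCom.br hc (ih.com _ (by omega) (by omega) (by omega) (by omega) (by omega))
        (h.com _ _ (by omega) (by omega) (by omega)))
  zl m h1 h2 := by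
    obtain rfl : m = n - 1 - k := by omega
    exact PZ.br_left h.hc (h.com _ _ (by omega) (by omega) (by omega)).1
      ((ih.sl _ (by omega)).right h.hc)
  zr := (PSer.br2 h.hc (ih.sr _ (by omega)) (h.com _ _ (by omega) (by omega) (by omega))).1
  sl m hm := PSer.br1 h.hc (h.com _ _ (by omega) (by omega) (by omega))
    (PSer.br1 h.hc (ih.com _ (by omega) (by omega) (by omega) (by omega) (by omega))
      (h.serL _ _ (by omega) (by omega)))
  sr m hm := PSer.br2 h.hc (h.serR _ _ (by omega) (by omega) (by omega))
    (PCom.br h.hc (ih.com _ (by omega) (by omega) (by omega) (by omega) (by omega))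
      (h.com _ _ (by omega) (by omega) (by omega)))

theorem cprop (h : Gens c n G) : ∀ k, k < n → CProp c n G k := by
  intro k
  induction k using Nat.strong_induction_on with
  | _ k ih =>
    intro hk
    cases k with
    | zero => exact cprop0 h
    | succ k =>
      exact cprop_succ h k hk (ih k (by omega) (by omega))
        (fun k' hk' => ih k' (by omega) (by omega))

/-- Unfolded form of `A_0`. -/
theorem ap0_eq (h : Gens c n G) (k : ℕ) (hk : k + 2 = n) :
    Ap c n G 0 = pbr c (G (2 * n)) (pbr c (G (2 * n - 1))
      (pbr c (pbr c (Cp c n G k) (G 1)) (G 0))) := by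
  have e1 : n - 1 = k + 1 := by omega
  have e2 : n + k + 1 = 2 * n - 1 := by omega
  have e3 : n - 1 - k = 1 := by omega
  rw [Ap, e1, Cp, e2, e3, pbr_assoc h.hc (h.com _ _ (by omega) (by omega) (by omega)).1]

theorem aprop0 (h : Gens c n G) : AProp c n G 0 := by
  have hn := h.hn
  have hc := h.hc
  obtain ⟨k, hk⟩ : ∃ k, k + 2 = n := ⟨n - 2, by omega⟩
  have C1 := cprop h (n - 1) (by omega)
  have C2 := cprop h k (by omega)
  refine ⟨?_, ?_, ?_, ?_, ?_⟩
  · intro m h1 h2 h3 h4 h5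
    exact PCom.br hc (h.com _ _ (by omega) (by omega) (by omega))
      (PCom.br hc (C1.com _ (by omega) (by omega) (by omega) (by omega) (by omega))
        (h.com _ _ (by omega) (by omega) (by omega)))
  · exact PZ.br_left hc (h.com _ _ (by omega) (by omega) (by omega)).1
      ((C1.sl _ (by omega)).right hc)
  · intro m hm
    obtain rfl : m = 2 * n := by omega
    exact (PSer.br2 hc (C1.sr _ (by omega)) (h.com _ _ (by omega) (by omega) (by omega))).1
  · intro _
    rw [ap0_eq h k hk]
    exact PSer.br1 hc (h.com _ _ (by omega) (by omega) (by omega))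
      (PSer.br1 hc (h.com _ _ (by omega) (by omega) (by omega))
        (PC hc (C2.com _ (by omega) (by omega) (by omega) (by omega) (by omega)).1
          (C2.sl _ (by omega)) h.ser3L (h.ne3 _ (by omega) (by omega))))
  · intro m _ hm
    obtain rfl : m = 2 * n - 1 := by omega
    rw [ap0_eq h k hk]
    refine PC' hc ?_ ?_ (h.ser3R _ (by omega)) (h.ne3 _ (by omega) (by omega))
    · refine PZ.br_right hc (PZ.br_right hc ?_ ?_) ?_
      · exact ((C2.com _ (by omega) (by omega) (by omega) (by omega) (by omega)).symm hc).1
      · exact (h.com _ _ (by omega) (by omega) (by omega)).1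
      · exact (h.com _ _ (by omega) (by omega) (by omega)).1
    · exact PSer.br2 hc (PSer.br2 hc (C2.sr _ (by omega))
        (h.com _ _ (by omega) (by omega) (by omega)))
        (h.com _ _ (by omega) (by omega) (by omega))

theorem aprop_succ (h : Gens c n G) (i : ℕ) (hi : i + 1 < n) (ih : AProp c n G i)
    (ih' : ∀ k', i = k' + 1 → AProp c n G k') : AProp c n G (i + 1) where
  com m h1 h2 h3 h4 h5 := by
    have hc := h.hc
    by_cases hm : m = i ∨ m + i = 2 * n
    · cases i with
      | zero =>
        obtain ⟨k, hk⟩ : ∃ k, k + 2 = n := ⟨n - 2, by omega⟩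
        have C2 := cprop h k (by omega)
        have e : Ap c n G (0 + 1) = pbr c (G (2 * n - 1)) (pbr c (G (2 * n)) (pbr c (G (2 * n - 1))
            (pbr c (pbr c (pbr c (Cp c n G k) (G 1)) (G 0)) (G 1)))) := by
          rw [Ap, ap0_eq h k hk, pbr_assoc hc (h.com _ _ (by omega) (by omega) (by omega)).1,
            pbr_assoc hc (h.com _ _ (by omega) (by omega) (by omega)).1]
          rfl
        rw [e]
        rcases hm with hm | hm
        · subst hm
          refine PCom.br hc (h.com _ _ (by omega) (by omega) (by omega))
            (PCom.br hc (h.com _ _ (by omega) (by omega) (by omega))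
            (PCom.br hc (h.com _ _ (by omega) (by omega) (by omega)) ?_))
          exact PL hc ((C2.sl _ (by omega)).right hc)
            (PSer.br1 hc (C2.com _ (by omega) (by omega) (by omega) (by omega) (by omega))
              (h.serL _ _ (by omega) (by omega))) (h.serL _ _ (by omega) (by omega))
            (h.ne2 _ (by omega) (by omega))
        · obtain rfl : m = 2 * n := by omega
          refine PL' hc ?_ ?_ (h.serR _ _ (by omega) (by omega) (by omega))
            (h.ne2 _ (by omega) (by omega))
          · exact (PSer.br2 hc (PSer.br2 hc (PSer.br2 hc (C2.sr _ (by omega))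
              (h.com _ _ (by omega) (by omega) (by omega)))
              (h.com _ _ (by omega) (by omega) (by omega)))
              (h.com _ _ (by omega) (by omega) (by omega))).1
          · exact PSer.br2 hc (h.serR _ _ (by omega) (by omega) (by omega))
              (PCom.br hc (PCom.br hc (PCom.br hc
                (C2.com _ (by omega) (by omega) (by omega) (by omega) (by omega))
                (h.com _ _ (by omega) (by omega) (by omega)))
                (h.com _ _ (by omega) (by omega) (by omega)))
                (h.com _ _ (by omega) (by omega) (by omega)))
      | succ k =>
        have IH := ih' k rfl
        have e : Ap c n G (k + 1 + 1) = pbr c (G (2 * n - (k + 1) - 1)) (pbr c (G (2 * n - k - 1))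
            (pbr c (pbr c (Ap c n G k) (G (k + 1))) (G (k + 1 + 1)))) := by
          rw [Ap, Ap, pbr_assoc hc (h.com _ _ (by omega) (by omega) (by omega)).1]
        rw [e]
        rcases hm with hm | hm
        · obtain rfl : m = k + 1 := by omega
          refine PCom.br hc (h.com _ _ (by omega) (by omega) (by omega))
            (PCom.br hc (h.com _ _ (by omega) (by omega) (by omega)) ?_)
          exact PL hc (IH.com _ (by omega) (by omega) (by omega) (by omega) (by omega)).1
            (IH.sl (by omega)) (h.serL _ _ (by omega) (by omega))
            (h.ne2 _ (by omega) (by omega))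
        · obtain rfl : m = 2 * n - k - 1 := by omega
          refine PL' hc ?_ ?_ (h.serR _ _ (by omega) (by omega) (by omega))
            (h.ne2 _ (by omega) (by omega))
          · refine PZ.br_right hc (PZ.br_right hc ?_ ?_) ?_
            · exact ((IH.com _ (by omega) (by omega) (by omega) (by omega) (by omega)).symm hc).1
            · exact (h.com _ _ (by omega) (by omega) (by omega)).1
            · exact (h.com _ _ (by omega) (by omega) (by omega)).1
          · exact PSer.br2 hc (PSer.br2 hc (IH.sr _ (by omega) (by omega))
              (h.com _ _ (by omega) (by omega) (by omega)))
              (h.com _ _ (by omega) (by omega) (by omega))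
    · exact PCom.br hc (h.com _ _ (by omega) (by omega) (by omega))
        (PCom.br hc (ih.com _ (by omega) (by omega) (by omega) (by omega) (by omega))
        (h.com _ _ (by omega) (by omega) (by omega)))
  zl := PZ.br_left h.hc (h.com _ _ (by omega) (by omega) (by omega)).1
      ((ih.sl (by omega)).right h.hc)
  zr m hm := by
    obtain rfl : m = 2 * n - i - 1 := by omega
    exact (PSer.br2 h.hc (ih.sr _ (by omega) (by omega))
      (h.com _ _ (by omega) (by omega) (by omega))).1
  sl _ := PSer.br1 h.hc (h.com _ _ (by omega) (by omega) (by omega))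
    (PSer.br1 h.hc (ih.com _ (by omega) (by omega) (by omega) (by omega) (by omega))
      (h.serL' _ _ (by omega) (by omega) (by omega)))
  sr m _ hm := PSer.br2 h.hc (h.serR' _ _ (by omega) (by omega) (by omega))
    (PCom.br h.hc (ih.com _ (by omega) (by omega) (by omega) (by omega) (by omega))
      (h.com _ _ (by omega) (by omega) (by omega)))

theorem aprop (h : Gens c n G) : ∀ k, k < n → AProp c n G k := by
  intro k
  induction k using Nat.strong_induction_on with
  | _ k ih =>
    intro hk
    cases k with
    | zero => exact aprop0 h
    | succ k =>
      exact aprop_succ h k hk (ih k (by omega) (by omega))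
        (fun k' hk' => ih k' (by omega) (by omega))
end Seq

section Conc

def dW (n t : ℕ) : ℤ := if t < n then 1 else -1

def wW (n i t : ℕ) : ℤ :=
  if i = 0 then (if t = 0 then -2 else 0)
  else if i = 2 * n then (if t = 2 * n - 1 then 2 else 0)
  else (if t = i - 1 then 1 else 0) - (if t = i then 1 else 0)

theorem Bfm_range (n i j : ℕ) :
    Bfm n i j = ∑ t ∈ Finset.range (2 * n), dW n t * wW n i t * wW n j t := by
  rw [← Fin.sum_univ_eq_sum_range (fun t => dW n t * wW n i t * wW n j t) (2 * n)]
  rfl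

theorem Bfm_zero_left (n j : ℕ) (hn : 2 ≤ n) : Bfm n 0 j = -2 * wW n j 0 := by
  rw [Bfm_range, Finset.sum_eq_single 0]
  · simp [dW, wW]; omega
  · intro t _ ht; simp [wW, ht]
  · intro h; simp at h; omega

theorem Bfm_last_left (n j : ℕ) (hn : 2 ≤ n) :
    Bfm n (2 * n) j = -2 * wW n j (2 * n - 1) := by
  rw [Bfm_range, Finset.sum_eq_single (2 * n - 1)]
  · have h1 : ¬ (2 * n - 1 < n) := by omega
    have h2 : ¬ (2 * n = 0) := by omega
    simp only [dW, wW, if_neg h1, if_neg h2, if_true]; ring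
  · intro t _ ht
    have h2 : ¬ (2 * n = 0) := by omega
    simp only [wW, if_neg h2, if_neg ht, if_true]; ring
  · intro h; simp at h; omega

theorem Bfm_mid_left (n i j : ℕ) (h0 : 1 ≤ i) (h1 : i < 2 * n) :
    Bfm n i j = dW n (i - 1) * wW n j (i - 1) - dW n i * wW n j i := by
  have h2 : ¬ (i = 0) := by omega
  have h3 : ¬ (i = 2 * n) := by omega
  have e : ∀ t, dW n t * wW n i t * wW n j t =
      (if t = i - 1 then dW n t * wW n j t else 0) - (if t = i then dW n t * wW n j t else 0) := by
    intro t
    simp only [wW, if_neg h2, if_neg h3]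
    split_ifs <;> ring
  rw [Bfm_range, Finset.sum_congr rfl (fun t _ => e t), Finset.sum_sub_distrib,
    Finset.sum_ite_eq', Finset.sum_ite_eq']
  have h4 : i - 1 ∈ Finset.range (2 * n) := by simp; omega
  have h5 : i ∈ Finset.range (2 * n) := by simp; omega
  simp only [h4, h5, if_true]

theorem Bfm_far (n i j : ℕ) (hn : 2 ≤ n) (hi : i ≤ 2 * n) (hj : j ≤ 2 * n)
    (h : i + 2 ≤ j ∨ j + 2 ≤ i) : Bfm n i j = 0 := by
  rcases Nat.eq_zero_or_pos i with rfl | h0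
  · rw [Bfm_zero_left n j hn]; unfold wW; split_ifs <;> omega
  · rcases Nat.lt_or_ge i (2 * n) with h1 | h1
    · rw [Bfm_mid_left n i j h0 h1]; unfold wW dW; split_ifs <;> omega
    · obtain rfl : i = 2 * n := by omega
      rw [Bfm_last_left n j hn]; unfold wW; split_ifs <;> omega

theorem Bfm_diag (n i : ℕ) (hn : 2 ≤ n) (hi : i ≤ 2 * n) :
    Bfm n i i = if i = 0 then 4 else if i < n then 2 else if i = n then 0
      else if i < 2 * n then -2 else -4 := by
  rcases Nat.eq_zero_or_pos i with rfl | h0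
  · rw [Bfm_zero_left n _ hn]; unfold wW; split_ifs <;> omega
  · rcases Nat.lt_or_ge i (2 * n) with h1 | h1
    · rw [Bfm_mid_left n i _ h0 h1]; unfold wW dW; split_ifs <;> omega
    · obtain rfl : i = 2 * n := by omega
      rw [Bfm_last_left n _ hn]; unfold wW; split_ifs <;> omega

theorem Bfm_up (n i j : ℕ) (hn : 2 ≤ n) (hj : j ≤ 2 * n) (h : j = i + 1) :
    Bfm n i j = if i = 0 then -2 else if i < n then -1 else if j < 2 * n then 1 else 2 := by
  rcases Nat.eq_zero_or_pos i with h0 | h0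
  · rw [h0, Bfm_zero_left n _ hn]; unfold wW; split_ifs <;> omega
  · rw [Bfm_mid_left n i _ h0 (by omega)]; unfold wW dW; split_ifs <;> omega

theorem Bfm_comm (n i j : ℕ) : Bfm n i j = Bfm n j i := by
  unfold Bfm
  exact Finset.sum_congr rfl fun t _ => by ring

variable {K : Type} [Field K] {n : ℕ} {χ : Lam n → Lam n → Kˣ}

def cχ (χ : Lam n → Lam n → Kˣ) (a b : Lam n) : K := (((χ b a)⁻¹ : Kˣ) : K)

def Gχ (K : Type) [Field K] (n : ℕ) (χ : Lam n → Lam n → Kˣ) (t : ℕ) :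
    Lam n × Unat K n χ := (αn n t, uEn K n χ t)

theorem Gχ_eq (t : ℕ) (h : t < 2 * n + 1) :
    Gχ K n χ t = (αr n ⟨t, h⟩, uE K n χ ⟨t, h⟩) := by
  simp [Gχ, αn, uEn, h]

theorem rel_zero {a : FA K n} (h : NRel K n χ a 0) :
    RingQuot.mkAlgHom K (NRel K n χ) a = 0 := by
  rw [RingQuot.mkAlgHom_rel K h, map_zero]

theorem mk_br (lam mu : Lam n) (X Y : FA K n) :
    RingQuot.mkAlgHom K (NRel K n χ) (fbrE K n χ lam mu X Y)
      = (pbr (cχ χ) (lam, RingQuot.mkAlgHom K (NRel K n χ) X)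
          (mu, RingQuot.mkAlgHom K (NRel K n χ) Y)).2 := by
  simp only [fbrE, pbr, cχ, map_sub, map_mul, map_smul]

theorem pz_com (i j : Fin (2 * n + 1)) (h : Bfm n i j = 0) :
    PZ (cχ χ) (αr n i, uE K n χ i) (αr n j, uE K n χ j) := by
  have := rel_zero (NRel.SE1 (K := K) (χ := χ) i j h)
  rw [mk_br] at this
  exact this

theorem pz_ser (i j : Fin (2 * n + 1)) (hne : i ≠ j) (h1 : -(2 * Bfm n i j) = Bfm n i i)
      (h2 : Bfm n i i ≠ 0) :
    PZ (cχ χ) (αr n i, uE K n χ i) (pbr (cχ χ) (αr n i, uE K n χ i) (αr n j, uE K n χ j)) := by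
  have := rel_zero (NRel.SE2 (K := K) (χ := χ) i j hne h1 h2)
  rw [mk_br, mk_br] at this
  exact this

theorem pz_ser3 (i j : Fin (2 * n + 1)) (hne : i ≠ j) (h1 : -(Bfm n i j) = Bfm n i i)
      (h2 : Bfm n i i ≠ 0) :
    PZ (cχ χ) (αr n i, uE K n χ i) (pbr (cχ χ) (αr n i, uE K n χ i)
      (pbr (cχ χ) (αr n i, uE K n χ i) (αr n j, uE K n χ j))) := by
  have := rel_zero (NRel.SE3 (K := K) (χ := χ) i j hne h1 h2)
  rw [mk_br, mk_br, mk_br] at this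
  exact this

theorem pz_odd (i j k : Fin (2 * n + 1)) (h1 : i ≠ j) (h2 : j ≠ k) (h3 : k ≠ i)
      (h4 : Bfm n i i = 0) (h5 : Bfm n j k = 0)
      (h6 : -(Bfm n i j) = Bfm n i k) (h7 : Bfm n i k ≠ 0) :
    PZ (cχ χ) (pbr (cχ χ) (αr n i, uE K n χ i) (αr n j, uE K n χ j))
      (pbr (cχ χ) (αr n i, uE K n χ i) (αr n k, uE K n χ k)) := by
  have := rel_zero (NRel.SE4 (K := K) (χ := χ) i j k h1 h2 h3 h4 h5 h6 h7)
  rw [mk_br, mk_br, mk_br] at this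
  exact this

set_option maxHeartbeats 2000000 in
theorem gens [CharZero K] (hn : 2 ≤ n)
    (q : Kˣ) (hq : ∀ m : ℕ, 0 < m → (q : K) ^ m ≠ 1)
    (hχ1 : ∀ a b c : Lam n, χ (a + b) c = χ a c * χ b c)
    (hχ2 : ∀ a b c : Lam n, χ a (b + c) = χ a b * χ a c)
    (hχd : ∀ i : Fin (2 * n + 1), Bfm n i i ≠ 0 → χ (αr n i) (αr n i) = q ^ (Bfm n i i))
    (hχ0 : ∀ i : Fin (2 * n + 1), Bfm n i i = 0 → ((χ (αr n i) (αr n i) : Kˣ) : K) = -1)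
    (hχij : ∀ i j : Fin (2 * n + 1), i ≠ j →
      χ (αr n i) (αr n j) * χ (αr n j) (αr n i) = q ^ (2 * Bfm n i j)) :
    Gens (cχ χ) n (Gχ K n χ) := by
  have hc : BC (cχ χ) := by
    refine ⟨fun a b d => ?_, fun a b d => ?_, fun a b => Units.ne_zero _⟩
    · simp only [cχ, hχ2, mul_inv, Units.val_mul]
    · simp only [cχ, hχ1, mul_inv, Units.val_mul]
  have hs : ∀ i j : Fin (2 * n + 1), i ≠ j → cχ χ (αr n i) (αr n j) * cχ χ (αr n j) (αr n i)
      = ((q ^ (-(2 * Bfm n i j)) : Kˣ) : K) := by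
    intro i j hij
    simp only [cχ]
    rw [← Units.val_mul, ← mul_inv, mul_comm, hχij i j hij, zpow_neg]
  have hd : ∀ i : Fin (2 * n + 1), Bfm n i i ≠ 0 → cχ χ (αr n i) (αr n i)
      = ((q ^ (-(Bfm n i i)) : Kˣ) : K) := by
    intro i hi
    simp only [cχ]
    rw [hχd i hi, zpow_neg]
  have hcom : ∀ i j, i ≤ 2 * n → j ≤ 2 * n → (i + 2 ≤ j ∨ j + 2 ≤ i) →
      PCom (cχ χ) (Gχ K n χ i) (Gχ K n χ j) := by
    intro i j hi hj hij
    rw [Gχ_eq i (by omega), Gχ_eq j (by omega)]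
    have hB : Bfm n i j = 0 := Bfm_far n i j hn hi hj hij
    refine ⟨pz_com _ _ hB, ?_⟩
    refine (hs _ _ (by intro h; rw [Fin.mk.injEq] at h; omega)).trans ?_
    simp only [hB]; simp
  have hser : ∀ i j : ℕ, i ≤ 2 * n → j ≤ 2 * n → i ≠ j → -(2 * Bfm n i j) = Bfm n i i →
      Bfm n i i ≠ 0 → PSer (cχ χ) (Gχ K n χ j) (Gχ K n χ i) := by
    intro i j hi hj hij h1 h2
    rw [Gχ_eq i (by omega), Gχ_eq j (by omega)]
    refine ⟨pz_ser _ _ (by intro h; rw [Fin.mk.injEq] at h; omega) h1 h2, ?_⟩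
    dsimp only
    rw [mul_comm (cχ χ (αr n ⟨j, _⟩) _), hs _ _ (by intro h; rw [Fin.mk.injEq] at h; omega), hd _ h2]
    dsimp only
    rw [← Units.val_mul, ← zpow_add, h1]; simp
  have hser3 : ∀ i j : ℕ, i ≤ 2 * n → j ≤ 2 * n → i ≠ j → -(Bfm n i j) = Bfm n i i →
      Bfm n i i ≠ 0 → PSer3 (cχ χ) (Gχ K n χ j) (Gχ K n χ i) := by
    intro i j hi hj hij h1 h2
    rw [Gχ_eq i (by omega), Gχ_eq j (by omega)]
    refine ⟨pz_ser3 _ _ (by intro h; rw [Fin.mk.injEq] at h; omega) h1 h2, ?_⟩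
    dsimp only
    rw [mul_comm (cχ χ (αr n ⟨j, _⟩) _), hs _ _ (by intro h; rw [Fin.mk.injEq] at h; omega), hd _ h2]
    dsimp only
    rw [← Units.val_mul, ← Units.val_mul, ← zpow_add, ← zpow_add,
      show -(2 * Bfm n i j) + -Bfm n i i + -Bfm n i i = 0 by omega]; simp
  have hpow : ∀ i : ℕ, i ≤ 2 * n → i ≠ n → ∀ m : ℕ, 0 < m →
      (cχ χ (Gχ K n χ i).1 (Gχ K n χ i).1) ^ m ≠ 1 := by
    intro i hi hin m hm hcon
    rw [Gχ_eq i (by omega)] at hcon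
    have hB := Bfm_diag n i hn hi
    have h2 : Bfm n i i ≠ 0 := by rw [hB]; split_ifs <;> omega
    dsimp only at hcon
    rw [hd _ h2, ← Units.val_pow_eq_pow_val, Units.val_eq_one, ← zpow_natCast, ← zpow_mul] at hcon
    dsimp only at hcon
    have h3 : q ^ ((-(Bfm n i i) * m).natAbs) = 1 := by
      rcases Int.natAbs_eq (-(Bfm n i i) * m) with h | h
      · rw [h, zpow_natCast] at hcon; exact hcon
      · rw [h, zpow_neg, zpow_natCast, inv_eq_one] at hcon; exact hcon
    refine hq ((-(Bfm n i i) * m).natAbs)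
      (Int.natAbs_pos.mpr (mul_ne_zero (neg_ne_zero.mpr h2) (by omega))) ?_
    rw [← Units.val_pow_eq_pow_val, h3, Units.val_one]
  have hnn : Bfm n n n = 0 := by
    rw [Bfm_diag n n hn (by omega)]; split_ifs <;> omega
  have htn : cχ χ (Gχ K n χ n).1 (Gχ K n χ n).1 = -1 := by
    rw [Gχ_eq n (by omega)]
    have := hχ0 ⟨n, by omega⟩ hnn
    simp only [cχ, Units.val_inv_eq_inv_val, this]
    rw [inv_neg, inv_one]
  have hnil : PZ (cχ χ) (Gχ K n χ n) (Gχ K n χ n) := by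
    rw [Gχ_eq n (by omega)]
    exact pz_com _ _ hnn
  refine ⟨hn, hc, hcom, ?_, ?_, ?_, ?_, ?_, ?_, ?_, ?_, hnil, ?_⟩
  · intro i j h1 h2
    have e1 := Bfm_up n i j hn (by omega) h1
    have e2 := Bfm_diag n i hn (by omega)
    refine hser i j (by omega) (by omega) (by omega) ?_ ?_ <;> split_ifs at e1 e2 <;> omega
  · intro i j h1 h2 h3
    have e1 := Bfm_up n i j hn (by omega) h1
    have e2 := Bfm_diag n j hn (by omega)
    rw [Bfm_comm] at e1
    refine hser j i (by omega) (by omega) (by omega) ?_ ?_ <;> split_ifs at e1 e2 <;> omega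
  · intro i j h1 h2 h3
    have e1 := Bfm_up n i j hn (by omega) h1
    have e2 := Bfm_diag n j hn (by omega)
    rw [Bfm_comm] at e1
    refine hser j i (by omega) (by omega) (by omega) ?_ ?_ <;> split_ifs at e1 e2 <;> omega
  · intro i j h1 h2 h3
    have e1 := Bfm_up n i j hn (by omega) h1
    have e2 := Bfm_diag n i hn (by omega)
    refine hser i j (by omega) (by omega) (by omega) ?_ ?_ <;> split_ifs at e1 e2 <;> omega
  · have e1 : Bfm n 1 0 = -2 := by
      rw [Bfm_comm, Bfm_up n 0 1 hn (by omega) rfl]; simp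
    have e2 : Bfm n 1 1 = 2 := by
      rw [Bfm_diag n 1 hn (by omega), if_neg (by omega), if_pos (by omega)]
    exact hser3 1 0 (by omega) (by omega) (by omega) (by omega) (by omega)
  · intro i hi
    have e1 := Bfm_up n i (2 * n) hn (by omega) hi.symm
    have e2 := Bfm_diag n i hn (by omega)
    refine hser3 i (2 * n) (by omega) (by omega) (by omega) ?_ ?_ <;> split_ifs at e1 e2 <;> omega
  · intro i hi hin h
    refine hpow i hi hin 2 (by omega) ?_
    linear_combination (cχ χ (Gχ K n χ i).1 (Gχ K n χ i).1 - 1) * h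
  · intro i hi hin h
    refine hpow i hi hin 3 (by omega) ?_
    linear_combination (cχ χ (Gχ K n χ i).1 (Gχ K n χ i).1 - 1) * h
  · intro i hi
    have e1 := Bfm_up n i n hn (by omega) hi.symm
    have e2 := Bfm_up n n (n + 1) hn (by omega) rfl
    have e3 := Bfm_far n i (n + 1) hn (by omega) (by omega) (by omega)
    rw [Bfm_comm] at e1
    refine PO hc (hcom _ _ (by omega) (by omega) (by omega)) ?_ htn ?_ ?_
    · exact PZ.sq_zero hnil htn
    · rw [Gχ_eq n (by omega), Gχ_eq i (by omega), Gχ_eq (n + 1) (by omega)]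
      dsimp only
      rw [mul_comm (cχ χ (αr n ⟨n + 1, _⟩) _), hs _ _ (by intro h; rw [Fin.mk.injEq] at h; omega),
        hs _ _ (by intro h; rw [Fin.mk.injEq] at h; omega)]
      dsimp only
      rw [← Units.val_mul, ← zpow_add]
      have : -(2 * Bfm n n (n + 1)) + -(2 * Bfm n n i) = 0 := by
        split_ifs at e1 e2 <;> omega
      rw [this]; simp
    · rw [Gχ_eq n (by omega), Gχ_eq i (by omega), Gχ_eq (n + 1) (by omega)]
      refine pz_odd _ _ _ (by intro h; rw [Fin.mk.injEq] at h; omega) (by intro h; rw [Fin.mk.injEq] at h; omega)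
        (by intro h; rw [Fin.mk.injEq] at h; omega) hnn e3 ?_ ?_ <;> dsimp only <;> split_ifs at e1 e2 <;> omega

theorem degB_step (i : ℕ) (hi : i + 1 < n) :
    degB n i = αn n (2 * n - i - 1) + (degB n (i + 1) + αn n (i + 1)) := by
  unfold degB
  have e : 2 * n - i - 1 = (2 * n - (i + 1) - 1) + 1 := by omega
  rw [e, Finset.sum_Icc_succ_top (by omega), ← Finset.add_sum_Ioc_eq_sum_Icc (a := i + 1) (by omega)]
  have e2 : Finset.Ioc (i + 1) (2 * n - (i + 1) - 1)
      = Finset.Icc (i + 1 + 1) (2 * n - (i + 1) - 1) := by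
    ext; simp only [Finset.mem_Ioc, Finset.mem_Icc]; omega
  rw [e2]
  abel

theorem Cp_eq (hn : 2 ≤ n) : ∀ k, k < n →
    Cp (cχ χ) n (Gχ K n χ) k = (degB n (n - 1 - k), Cseq K n χ k) := by
  intro k
  induction k with
  | zero =>
    intro _
    refine Prod.ext ?_ rfl
    have e : n - 1 - 0 + 1 = n := by omega
    have e' : 2 * n - (n - 1 - 0) - 1 = n := by omega
    show αn n n = degB n (n - 1 - 0)
    unfold degB
    rw [e, e', Finset.Icc_self, Finset.sum_singleton]
  | succ k ih =>
    intro hk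
    rw [Cp, ih (by omega)]
    refine Prod.ext ?_ rfl
    have := degB_step (n := n) (n - 1 - (k + 1)) (by omega)
    rw [this]
    have e : n - 1 - (k + 1) + 1 = n - 1 - k := by omega
    have e' : 2 * n - (n - 1 - (k + 1)) - 1 = n + k + 1 := by omega
    rw [e, e']
    rfl

theorem degA_step (i : ℕ) (hi : i + 1 < n) :
    degA n (i + 1) = αn n (2 * n - i - 1) + (degA n i + αn n (i + 1)) := by
  unfold degA
  have e2 : Finset.Ioc (2 * n - (i + 1)) (2 * n - 1) = Finset.Icc (2 * n - i) (2 * n - 1) := by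
    ext; simp; omega
  rw [Finset.sum_Icc_succ_top (by omega),
    ← Finset.add_sum_Ioc_eq_sum_Icc (a := 2 * n - (i + 1)) (by omega), e2,
    show 2 * n - (i + 1) = 2 * n - i - 1 by omega]
  abel

theorem Ap_eq (hn : 2 ≤ n) : ∀ k, k < n →
    Ap (cχ χ) n (Gχ K n χ) k = (degA n k, Aseq K n χ k) := by
  intro k
  induction k with
  | zero =>
    intro _
    rw [Ap, Cp_eq hn _ (by omega), show n - 1 - (n - 1) = 0 by omega]
    refine Prod.ext ?_ rfl
    have : Finset.Icc (2 * n) (2 * n - 1) = ∅ := by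
      rw [Finset.Icc_eq_empty]; omega
    simp [pbr, Gχ, degA, degBm1, this, add_assoc]
  | succ k ih =>
    intro hk
    rw [Ap, ih (by omega)]
    refine Prod.ext ?_ rfl
    rw [degA_step k hk]
    rfl

end Conc

/-- commutation properties of the elements `A_i` and `B_i` of
`U^♮_χ` (case of `sl^{(2)}(2n|2n)`):
`⌊B_i,E_j⌋ = 0` for `j ∉ {i, N−i−1, N−i}`, `⌊E_{N−i−1},B_i⌋ = 0`,
`⌊A_i,E_j⌋ = 0` for `j ∉ {i+1, N−i−1, N−i}`, and `⌊E_{N−i},A_i⌋ = 0`. -/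
theorem stmt19 (K : Type) [Field K] [CharZero K] (n : ℕ) (hn : 2 ≤ n)
    (q : Kˣ) (hq : ∀ m : ℕ, 0 < m → (q : K) ^ m ≠ 1)
    (χ : Lam n → Lam n → Kˣ)
    (hχ1 : ∀ a b c : Lam n, χ (a + b) c = χ a c * χ b c)
    (hχ2 : ∀ a b c : Lam n, χ a (b + c) = χ a b * χ a c)
    (hχd : ∀ i : Fin (2 * n + 1), Bfm n i i ≠ 0 → χ (αr n i) (αr n i) = q ^ (Bfm n i i))
    (hχ0 : ∀ i : Fin (2 * n + 1), Bfm n i i = 0 → ((χ (αr n i) (αr n i) : Kˣ) : K) = -1)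
    (hχij : ∀ i j : Fin (2 * n + 1), i ≠ j →
      χ (αr n i) (αr n j) * χ (αr n j) (αr n i) = q ^ (2 * Bfm n i j))
    (hχdd : χ (dr n) (dr n) = 1)
    (hχdi : ∀ i : Fin (2 * n + 1),
      χ (dr n) (αr n i) = q ^ (if (i : ℕ) = 0 then (1 : ℕ) else 0) ∧
      χ (αr n i) (dr n) = q ^ (if (i : ℕ) = 0 then (1 : ℕ) else 0)) :
    ∀ i : ℕ, i < n →
      (∀ j : Fin (2 * n + 1),
        (j : ℕ) ≠ i → (j : ℕ) ≠ 2 * n - i - 1 → (j : ℕ) ≠ 2 * n - i →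
        ubrE K n χ (degB n i) (αr n j) (Bseq K n χ i) (uE K n χ j) = 0) ∧
      (ubrE K n χ (αn n (2 * n - i - 1)) (degB n i)
        (uEn K n χ (2 * n - i - 1)) (Bseq K n χ i) = 0) ∧
      (∀ j : Fin (2 * n + 1),
        (j : ℕ) ≠ i + 1 → (j : ℕ) ≠ 2 * n - i - 1 → (j : ℕ) ≠ 2 * n - i →
        ubrE K n χ (degA n i) (αr n j) (Aseq K n χ i) (uE K n χ j) = 0) ∧
      (ubrE K n χ (αn n (2 * n - i)) (degA n i)
        (uEn K n χ (2 * n - i)) (Aseq K n χ i) = 0) := by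
  have H := gens (K := K) (n := n) (χ := χ) hn q hq hχ1 hχ2 hχd hχ0 hχij
  intro i hi
  have C := cprop H (n - 1 - i) (by omega)
  have A := aprop H i hi
  have eC := Cp_eq (K := K) (n := n) (χ := χ) hn (n - 1 - i) (by omega)
  have eA := Ap_eq (K := K) (n := n) (χ := χ) hn i hi
  rw [show n - 1 - (n - 1 - i) = i by omega] at eC
  refine ⟨?_, ?_, ?_, ?_⟩
  · intro j h1 h2 h3
    have hj := j.2
    have h : PZ (cχ χ) (Cp (cχ χ) n (Gχ K n χ) (n - 1 - i)) (Gχ K n χ j) := by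
      by_cases hji : (j : ℕ) = i + 1
      · exact C.zl _ (by omega) (by omega)
      · exact (C.com _ (by omega) (by omega) (by omega) (by omega) (by omega)).1
    rw [eC, Gχ_eq _ hj] at h
    exact h
  · have h := C.zr
    rw [eC, show n + (n - 1 - i) = 2 * n - i - 1 by omega] at h
    exact h
  · intro j h1 h2 h3
    have hj := j.2
    have h : PZ (cχ χ) (Ap (cχ χ) n (Gχ K n χ) i) (Gχ K n χ j) := by
      by_cases hji : (j : ℕ) = i
      · rw [hji]; exact A.zl
      · exact (A.com _ (by omega) (by omega) (by omega) (by omega) (by omega)).1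
    rw [eA, Gχ_eq _ hj] at h
    exact h
  · have h := A.zr (2 * n - i) (by omega)
    rw [eA] at h
    exact h
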